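/- Let p : (0,1) → [0,∞) be continuous and integrable with p(θ₀) > 0, θ₀ ∈ (0,1), and let d(t,θ₀) be the Bernoulli KL divergence from θ₀ to t. Then as n → ∞, ∫_{(0,1)} p(t)·e^{-n·d(t,θ₀)}·(t-θ₀)² dt ∼ √(2π)·p(θ₀)·(n·d''(θ₀))^{-3/2}, where d''(θ₀) = 1/(θ₀(1-θ₀)). -/

import Mathlib

open Set Filter MeasureTheory

namespace LapAux

lemma d_lower {θ t : ℝ} (hθ : θ ∈ Ioo (0:ℝ) 1) (ht : t ∈ Ioo (0:ℝ) 1) :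
    (t - θ) ^ 2 / 4 ≤ θ * Real.log (θ / t) + (1 - θ) * Real.log ((1 - θ) / (1 - t)) := by
  have key : ∀ x y : ℝ, 0 < x → 0 < y →
      2 * x - 2 * (Real.sqrt x * Real.sqrt y) ≤ x * Real.log (x / y) := by
    intro x y hx hy
    have ha := Real.sqrt_pos.2 hx
    have hb := Real.sqrt_pos.2 hy
    have hx2 := Real.sq_sqrt hx.le
    have hy2 := Real.sq_sqrt hy.le
    have h1 : Real.log (x / y) = -(2 * Real.log (Real.sqrt y / Real.sqrt x)) := by
      rw [Real.log_div hx.ne' hy.ne', Real.log_div hb.ne' ha.ne', Real.log_sqrt hx.le,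
        Real.log_sqrt hy.le]
      ring
    have h2 := Real.log_le_sub_one_of_pos (div_pos hb ha)
    rw [h1]
    have h3 : x * Real.log (Real.sqrt y / Real.sqrt x) ≤ x * (Real.sqrt y / Real.sqrt x - 1) :=
      mul_le_mul_of_nonneg_left h2 hx.le
    have h4 : x * (Real.sqrt y / Real.sqrt x) = Real.sqrt x * Real.sqrt y := by
      field_simp
      nlinarith
    nlinarith
  have k1 := key θ t hθ.1 ht.1
  have k2 := key (1 - θ) (1 - t) (by linarith [hθ.2]) (by linarith [ht.2])
  have a2 := Real.sq_sqrt hθ.1.le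
  have b2 := Real.sq_sqrt ht.1.le
  have c2 := Real.sq_sqrt (show 0 ≤ 1 - θ by linarith [hθ.2])
  have e2 := Real.sq_sqrt (show 0 ≤ 1 - t by linarith [ht.2])
  have a1 : Real.sqrt θ ≤ 1 := Real.sqrt_le_one.2 hθ.2.le
  have b1 : Real.sqrt t ≤ 1 := Real.sqrt_le_one.2 ht.2.le
  have a0 := Real.sqrt_nonneg θ
  have b0 := Real.sqrt_nonneg t
  set a := Real.sqrt θ
  set b := Real.sqrt t
  set c := Real.sqrt (1 - θ)
  set e := Real.sqrt (1 - t)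
  have h5 : (t - θ) ^ 2 / 4 ≤ (b - a) ^ 2 := by
    have : t - θ = (b - a) * (b + a) := by nlinarith
    rw [this, mul_pow]
    have : (b + a) ^ 2 ≤ 4 := by nlinarith
    nlinarith [mul_le_mul_of_nonneg_left this (sq_nonneg (b - a))]
  nlinarith [sq_nonneg (c - e)]

lemma d_quad {θ : ℝ} (hθ : θ ∈ Ioo (0:ℝ) 1) (d : ℝ → ℝ)
    (hd : ∀ t, d t = θ * Real.log (θ / t) + (1 - θ) * Real.log ((1 - θ) / (1 - t))) :
    Tendsto (fun t => d t / (t - θ) ^ 2) (nhdsWithin θ {θ}ᶜ) (nhds (1 / (2 * (θ * (1 - θ))))) := by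
  obtain ⟨h0, h1⟩ := hθ
  have hmem : ∀ᶠ t in nhds θ, t ∈ Ioo (0:ℝ) 1 := Ioo_mem_nhds h0 h1
  have hder : ∀ t ∈ Ioo (0:ℝ) 1, HasDerivAt d ((t - θ) / (t * (1 - t))) t := by
    intro t ht
    have e1 : ∀ᶠ x in nhds t, d x = θ * (Real.log θ - Real.log x) +
        (1 - θ) * (Real.log (1 - θ) - Real.log (1 - x)) := by
      filter_upwards [Ioo_mem_nhds ht.1 ht.2] with x hx
      rw [hd, Real.log_div h0.ne' hx.1.ne', Real.log_div (by linarith) (by linarith [hx.2])]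
    refine HasDerivAt.congr_of_eventuallyEq ?_ e1
    have t0 : t ≠ 0 := ht.1.ne'
    have t1 : 1 - t ≠ 0 := by linarith [ht.2]
    have := (((Real.hasDerivAt_log t0).const_sub (Real.log θ)).const_mul θ).add
      (((((hasDerivAt_id t).const_sub 1).log t1).const_sub (Real.log (1 - θ))).const_mul (1 - θ))
    refine HasDerivAt.congr_deriv (f := fun x => θ * (Real.log θ - Real.log x) +
        (1 - θ) * (Real.log (1 - θ) - Real.log (1 - x))) this ?_
    simp only [id]
    field_simp
    ring
  have dθ : d θ = 0 := by
    rw [hd, div_self h0.ne', div_self (by linarith)]; simp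
  refine HasDerivAt.lhopital_zero_nhdsNE (f' := fun t => (t - θ) / (t * (1 - t)))
    (g' := fun t => 2 * (t - θ)) ?_ ?_ ?_ ?_ ?_ ?_
  · exact eventually_nhdsWithin_of_eventually_nhds (hmem.mono hder)
  · refine Eventually.of_forall fun t => ?_
    have := ((hasDerivAt_id t).sub_const θ).pow 2
    refine HasDerivAt.congr_deriv (f := fun x => (x - θ) ^ 2) this ?_
    simp
  · filter_upwards [self_mem_nhdsWithin] with t ht
    exact mul_ne_zero two_ne_zero (sub_ne_zero.2 ht)
  · refine tendsto_nhdsWithin_of_tendsto_nhds ?_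
    have := (hder θ ⟨h0, h1⟩).continuousAt.tendsto
    rwa [dθ] at this
  · refine tendsto_nhdsWithin_of_tendsto_nhds ?_
    have : Continuous fun t : ℝ => (t - θ) ^ 2 := by fun_prop
    simpa using this.tendsto θ
  · have hc : ContinuousAt (fun t : ℝ => 1 / (2 * (t * (1 - t)))) θ := by
      refine ContinuousAt.div (by fun_prop) (by fun_prop) ?_
      have : 0 < θ * (1 - θ) := mul_pos h0 (by linarith)
      positivity
    refine (tendsto_nhdsWithin_of_tendsto_nhds hc.tendsto).congr' ?_
    filter_upwards [self_mem_nhdsWithin, eventually_nhdsWithin_of_eventually_nhds hmem] with t ht ht2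
    have : t - θ ≠ 0 := sub_ne_zero.2 ht
    have t0 : t ≠ 0 := ht2.1.ne'
    have t1 : 1 - t ≠ 0 := by linarith [ht2.2]
    field_simp

lemma gauss {v : ℝ} (hv : 0 < v) :
    ∫ u : ℝ, Real.exp (-(u ^ 2 / (2 * v))) * u ^ 2 =
      Real.sqrt (2 * Real.pi) * (v * Real.sqrt v) := by
  lift v to NNReal using hv.le
  have h := ProbabilityTheory.variance_fun_id_gaussianReal (μ := 0) (v := v)
  rw [ProbabilityTheory.variance_eq_integral measurable_id'.aemeasurable] at h
  simp only [ProbabilityTheory.integral_id_gaussianReal] at h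
  rw [ProbabilityTheory.integral_gaussianReal_eq_integral_smul
    (by rintro rfl; simp at hv)] at h
  simp only [ProbabilityTheory.gaussianPDFReal, sub_zero, smul_eq_mul, mul_assoc,
    integral_const_mul] at h
  have hs : 0 < Real.sqrt (2 * (Real.pi * v)) := Real.sqrt_pos.2 (by positivity)
  rw [inv_mul_eq_iff_eq_mul₀ hs.ne'] at h
  simp only [neg_div] at h
  rw [h, ← mul_assoc 2, Real.sqrt_mul (by positivity)]
  ring

end LapAux

theorem laplace_second_moment
    (p : ℝ → ℝ) (hp_nonneg : ∀ t ∈ Ioo (0:ℝ) 1, 0 ≤ p t)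
    (hp_cont : ContinuousOn p (Ioo (0:ℝ) 1))
    (hp_int : IntegrableOn p (Ioo (0:ℝ) 1))
    (θ₀ : ℝ) (hθ₀ : θ₀ ∈ Ioo (0:ℝ) 1) (hpθ₀ : 0 < p θ₀)
    (d : ℝ → ℝ)
    (hd : ∀ t, d t = θ₀ * Real.log (θ₀ / t) + (1 - θ₀) * Real.log ((1 - θ₀) / (1 - t))) :
    Tendsto (fun n : ℕ =>
      (∫ t in Ioo (0:ℝ) 1, p t * Real.exp (-(n : ℝ) * d t) * (t - θ₀) ^ 2) /
        (Real.sqrt (2 * Real.pi) * p θ₀ *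
          ((n : ℝ) * (1 / (θ₀ * (1 - θ₀)))) ^ (-(3:ℝ) / 2)))
      atTop (nhds 1) := by
  have hlow : ∀ t ∈ Ioo (0:ℝ) 1, (t - θ₀) ^ 2 / 4 ≤ d t := fun t ht => by
    rw [hd]; exact LapAux.d_lower hθ₀ ht
  have hdm : Measurable d := by
    rw [show d = _ from funext hd]
    fun_prop
  have hpc : ContinuousAt p θ₀ := hp_cont.continuousAt (Ioo_mem_nhds hθ₀.1 hθ₀.2)
  have hv : 0 < θ₀ * (1 - θ₀) := mul_pos hθ₀.1 (by linarith [hθ₀.2])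
  set v := θ₀ * (1 - θ₀) with hvdef
  -- the neighbourhood
  obtain ⟨δ, hδ, hB⟩ := Metric.eventually_nhds_iff_ball.1
    ((hpc.eventually (gt_mem_nhds (lt_add_one (p θ₀)))).and (Ioo_mem_nhds hθ₀.1 hθ₀.2 :
      ∀ᶠ t in nhds θ₀, t ∈ Ioo (0:ℝ) 1))
  set B := Metric.ball θ₀ δ with hBdef
  have hBsub : B ⊆ Ioo (0:ℝ) 1 := fun t ht => (hB t ht).2
  have hBm : MeasurableSet B := measurableSet_ball
  set q : ℝ → ℝ := B.indicator p with hq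
  have hqm : Measurable q := by
    classical
    rw [hq, ← Set.piecewise_eq_indicator]
    exact (hp_cont.mono hBsub).measurable_piecewise continuousOn_const hBm
  have hq0 : ∀ t, 0 ≤ q t := fun t => Set.indicator_nonneg (fun t ht => hp_nonneg t (hBsub ht)) t
  have hexp1 : ∀ (n : ℕ), ∀ t ∈ Ioo (0:ℝ) 1, Real.exp (-(n:ℝ) * d t) ≤ 1 := by
    intro n t ht
    rw [Real.exp_le_one_iff]
    have := hlow t ht
    have : 0 ≤ d t := le_trans (by positivity) this
    have : 0 ≤ (n:ℝ) * d t := by positivity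
    linarith
  have hsq1 : ∀ t ∈ Ioo (0:ℝ) 1, (t - θ₀) ^ 2 ≤ 1 := by
    intro t ht
    have := hθ₀.1; have := hθ₀.2; have := ht.1; have := ht.2
    nlinarith
  -- integrability
  have hfint : ∀ n : ℕ, IntegrableOn (fun t => p t * Real.exp (-(n : ℝ) * d t) * (t - θ₀) ^ 2)
      (Ioo (0:ℝ) 1) := by
    intro n
    refine Integrable.mono' hp_int ?_ ?_
    · refine (hp_int.aestronglyMeasurable.mul ?_).mul ?_
      · exact Measurable.aestronglyMeasurable (by fun_prop)
      · exact Measurable.aestronglyMeasurable (by fun_prop)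
    · refine (ae_restrict_iff' measurableSet_Ioo).2 (Eventually.of_forall fun t ht => ?_)
      have h0 := hp_nonneg t ht
      rw [Real.norm_of_nonneg (by positivity)]
      calc p t * Real.exp (-(n : ℝ) * d t) * (t - θ₀) ^ 2 ≤ p t * 1 * 1 := by
            gcongr
            · exact hexp1 n t ht
            · exact hsq1 t ht
        _ = p t := by ring
  -- near part
  have hnear : Tendsto (fun n : ℕ => ∫ u : ℝ, q (θ₀ + u / Real.sqrt n) *
      Real.exp (-(n:ℝ) * d (θ₀ + u / Real.sqrt n)) * u ^ 2) atTop
      (nhds (∫ u : ℝ, p θ₀ * (Real.exp (-(u ^ 2 / (2 * v))) * u ^ 2))) := by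
    refine tendsto_integral_filter_of_dominated_convergence
      (fun u => (p θ₀ + 1) * (u ^ (2:ℝ) * Real.exp (-(1/4) * u ^ 2))) ?_ ?_ ?_ ?_
    · refine Eventually.of_forall fun n => Measurable.aestronglyMeasurable ?_
      fun_prop
    · filter_upwards [eventually_ge_atTop 1] with n hn
      refine Eventually.of_forall fun u => ?_
      have hn' : (0:ℝ) < n := by exact_mod_cast hn
      rw [Real.norm_of_nonneg (mul_nonneg (mul_nonneg (hq0 _) (Real.exp_nonneg _)) (sq_nonneg _))]
      rw [Real.rpow_two]
      by_cases hu : θ₀ + u / Real.sqrt n ∈ B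
      · have h1 : q (θ₀ + u / Real.sqrt n) ≤ p θ₀ + 1 := by
          rw [hq, Set.indicator_of_mem hu]; exact (hB _ hu).1.le
        have h2 := hlow _ (hBsub hu)
        have h3 : -(n:ℝ) * d (θ₀ + u / Real.sqrt n) ≤ -(1/4) * u ^ 2 := by
          have h4 : (n:ℝ) * ((θ₀ + u / Real.sqrt n - θ₀) ^ 2 / 4) = u ^ 2 / 4 := by
            rw [add_sub_cancel_left, div_pow, Real.sq_sqrt hn'.le]
            field_simp
          nlinarith [mul_le_mul_of_nonneg_left h2 hn'.le]
        calc _ ≤ (p θ₀ + 1) * Real.exp (-(1/4) * u ^ 2) * u ^ 2 := by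
              gcongr
          _ = _ := by ring
      · rw [hq, Set.indicator_of_notMem hu]
        simp only [zero_mul]
        positivity
    · exact (integrable_rpow_mul_exp_neg_mul_sq (by norm_num) (by norm_num)).const_mul _
    · refine Eventually.of_forall fun u => ?_
      by_cases hu : u = 0
      · simp [hu]
      have hs : Tendsto (fun n : ℕ => Real.sqrt n) atTop atTop :=
        Real.tendsto_sqrt_atTop.comp tendsto_natCast_atTop_atTop
      have ht : Tendsto (fun n : ℕ => θ₀ + u / Real.sqrt n) atTop (nhds θ₀) := by
        simpa using (tendsto_const_nhds (x := u)).div_atTop hs |>.const_add θ₀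
      have ht' : Tendsto (fun n : ℕ => θ₀ + u / Real.sqrt n) atTop (nhdsWithin θ₀ {θ₀}ᶜ) := by
        refine tendsto_nhdsWithin_iff.2 ⟨ht, ?_⟩
        filter_upwards [eventually_ge_atTop 1] with n hn
        have hn' : (0:ℝ) < n := by exact_mod_cast hn
        have := Real.sqrt_pos.2 hn'
        simp [hu, this.ne']
      have hqt : Tendsto (fun n : ℕ => q (θ₀ + u / Real.sqrt n)) atTop (nhds (p θ₀)) := by
        refine (hpc.tendsto.comp ht).congr' ?_
        filter_upwards [ht.eventually (Metric.ball_mem_nhds θ₀ hδ)] with n hn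
        have hn2 : θ₀ + u / Real.sqrt n ∈ B := hn
        rw [hq, Set.indicator_of_mem hn2]; rfl
      have hdt := (LapAux.d_quad hθ₀ d hd).comp ht'
      have hdt2 : Tendsto (fun n : ℕ => -(n:ℝ) * d (θ₀ + u / Real.sqrt n)) atTop
          (nhds (-(u ^ 2 / (2 * v)))) := by
        have h := (hdt.mul_const (u ^ 2)).neg
        rw [show -(u ^ 2 / (2 * v)) = -(1 / (2 * v) * u ^ 2) by ring]
        refine h.congr' ?_
        filter_upwards [eventually_ge_atTop 1] with n hn
        have hn' : (0:ℝ) < n := by exact_mod_cast hn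
        simp only [Function.comp, add_sub_cancel_left, div_pow, Real.sq_sqrt hn'.le]
        field_simp
      have := (hqt.mul ((Real.continuous_exp.tendsto _).comp hdt2)).mul_const (u ^ 2)
      rw [mul_assoc] at this
      exact this
  rw [integral_const_mul, LapAux.gauss hv] at hnear
  -- change of variables
  have hcv : ∀ n : ℕ, 1 ≤ n → (∫ u : ℝ, q (θ₀ + u / Real.sqrt n) *
      Real.exp (-(n:ℝ) * d (θ₀ + u / Real.sqrt n)) * u ^ 2) =
      (n * Real.sqrt n) * ∫ t in B, p t * Real.exp (-(n : ℝ) * d t) * (t - θ₀) ^ 2 := by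
    intro n hn
    have hn' : (0:ℝ) < n := by exact_mod_cast hn
    have hsn := Real.sqrt_pos.2 hn'
    have e1 : ∀ u : ℝ, q (θ₀ + u / Real.sqrt n) *
        Real.exp (-(n:ℝ) * d (θ₀ + u / Real.sqrt n)) * u ^ 2 =
        (fun h : ℝ => (fun t : ℝ => n * (q t * Real.exp (-(n:ℝ) * d t) * (t - θ₀) ^ 2)) (θ₀ + h))
          (u / Real.sqrt n) := by
      intro u
      simp only [add_sub_cancel_left, div_pow, Real.sq_sqrt hn'.le]
      field_simp
    simp_rw [e1]
    rw [Measure.integral_comp_div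
      (fun h : ℝ => (fun t : ℝ => n * (q t * Real.exp (-(n:ℝ) * d t) * (t - θ₀) ^ 2)) (θ₀ + h)),
      integral_add_left_eq_self
        (fun t : ℝ => (n:ℝ) * (q t * Real.exp (-(n:ℝ) * d t) * (t - θ₀) ^ 2)),
      integral_const_mul, abs_of_pos hsn, ← integral_indicator hBm, smul_eq_mul]
    have e2 : ∀ t, q t * Real.exp (-(n:ℝ) * d t) * (t - θ₀) ^ 2 =
        B.indicator (fun t => p t * Real.exp (-(n : ℝ) * d t) * (t - θ₀) ^ 2) t := by
      intro t
      by_cases ht : t ∈ B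
      · rw [hq, Set.indicator_of_mem ht, Set.indicator_of_mem ht]
      · rw [hq, Set.indicator_of_notMem ht, Set.indicator_of_notMem ht]; simp
    simp_rw [e2]
    ring
  -- far part
  have hfar : Tendsto (fun n : ℕ => (n * Real.sqrt n) *
      ∫ t in Ioo (0:ℝ) 1 \ B, p t * Real.exp (-(n : ℝ) * d t) * (t - θ₀) ^ 2) atTop (nhds 0) := by
    have hz := ((tendsto_rpow_mul_exp_neg_mul_atTop_nhds_zero (3/2) (δ^2/4) (by positivity)).comp
      (tendsto_natCast_atTop_atTop (R := ℝ))).mul_const (∫ t in Ioo (0:ℝ) 1, p t)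
    rw [zero_mul] at hz
    have hpos : ∀ n : ℕ, ∀ t ∈ Ioo (0:ℝ) 1, 0 ≤ p t * Real.exp (-(n : ℝ) * d t) * (t - θ₀) ^ 2 :=
      fun n t ht => mul_nonneg (mul_nonneg (hp_nonneg t ht) (Real.exp_nonneg _)) (sq_nonneg _)
    have hDm : MeasurableSet (Ioo (0:ℝ) 1 \ B) := measurableSet_Ioo.diff hBm
    refine squeeze_zero' (Eventually.of_forall fun n => ?_) ?_ hz
    · exact mul_nonneg (by positivity) (setIntegral_nonneg hDm fun t ht => hpos n t ht.1)
    · filter_upwards [eventually_ge_atTop 1] with n hn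
      have hn' : (0:ℝ) < n := by exact_mod_cast hn
      have e3 : (n:ℝ) ^ (3/2 : ℝ) = n * Real.sqrt n := by
        rw [Real.sqrt_eq_rpow, show (3/2:ℝ) = 1 + 1/2 by norm_num, Real.rpow_add hn', Real.rpow_one]
      simp only [Function.comp]
      rw [e3, mul_assoc ((n:ℝ) * Real.sqrt n) (Real.exp _)]
      have hnn : 0 ≤ (n:ℝ) * Real.sqrt n := by positivity
      refine mul_le_mul_of_nonneg_left ?_ hnn
      have hpi : IntegrableOn p (Ioo (0:ℝ) 1 \ B) := hp_int.mono_set sdiff_subset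
      calc _ ≤ ∫ t in Ioo (0:ℝ) 1 \ B, Real.exp (-(δ^2/4) * n) * p t := by
            refine setIntegral_mono_on ((hfint n).mono_set sdiff_subset) (hpi.const_mul _) hDm ?_
            intro t ht
            have h0 := hp_nonneg t ht.1
            have h1 : δ ^ 2 ≤ (t - θ₀) ^ 2 := by
              have := ht.2
              rw [hBdef, Metric.mem_ball, Real.dist_eq, not_lt] at this
              rw [← sq_abs (t - θ₀)]
              gcongr
            have h2 := hlow t ht.1
            have h3 : -(n:ℝ) * d t ≤ -(δ^2/4) * n := by
              nlinarith [mul_le_mul_of_nonneg_left (show δ^2/4 ≤ d t by linarith) hn'.le]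
            calc p t * Real.exp (-(n : ℝ) * d t) * (t - θ₀) ^ 2
                ≤ p t * Real.exp (-(δ^2/4) * n) * 1 := by
                  gcongr
                  exact hsq1 t ht.1
              _ = _ := by ring
        _ = Real.exp (-(δ^2/4) * n) * ∫ t in Ioo (0:ℝ) 1 \ B, p t := integral_const_mul _ _
        _ ≤ _ := by
            refine mul_le_mul_of_nonneg_left ?_ (Real.exp_nonneg _)
            refine setIntegral_mono_set hp_int ?_ (sdiff_subset.eventuallyLE)
            exact (ae_restrict_iff' measurableSet_Ioo).2 (Eventually.of_forall hp_nonneg)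
  have hsum := (hnear.add hfar).div_const (Real.sqrt (2 * Real.pi) * p θ₀ * (v * Real.sqrt v))
  have hsv := Real.sqrt_pos.2 hv
  have hs2 : 0 < Real.sqrt (2 * Real.pi) := Real.sqrt_pos.2 (by positivity)
  have hone : (p θ₀ * (Real.sqrt (2 * Real.pi) * (v * Real.sqrt v)) + 0) /
      (Real.sqrt (2 * Real.pi) * p θ₀ * (v * Real.sqrt v)) = 1 := by
    rw [add_zero, div_eq_one_iff_eq (by positivity)]; ring
  rw [hone] at hsum
  refine hsum.congr' ?_
  filter_upwards [eventually_ge_atTop 1] with n hn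
  have hn' : (0:ℝ) < n := by exact_mod_cast hn
  have hsn := Real.sqrt_pos.2 hn'
  rw [hcv n hn, ← mul_add]
  have e4 : (∫ t in B, p t * Real.exp (-(n : ℝ) * d t) * (t - θ₀) ^ 2) +
      (∫ t in Ioo (0:ℝ) 1 \ B, p t * Real.exp (-(n : ℝ) * d t) * (t - θ₀) ^ 2) =
      ∫ t in Ioo (0:ℝ) 1, p t * Real.exp (-(n : ℝ) * d t) * (t - θ₀) ^ 2 := by
    rw [← setIntegral_union disjoint_sdiff_right (measurableSet_Ioo.diff hBm)
      ((hfint n).mono_set hBsub) ((hfint n).mono_set sdiff_subset), union_sdiff_cancel hBsub]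
  rw [e4]
  have e5 : ((n:ℝ) * (1 / v)) ^ (-(3:ℝ) / 2) = (v * Real.sqrt v) / (n * Real.sqrt n) := by
    rw [mul_one_div, show -(3:ℝ)/2 = -(1 + 1/2) by norm_num, Real.rpow_neg (by positivity),
      Real.rpow_add (by positivity), Real.rpow_one, ← Real.sqrt_eq_rpow, Real.sqrt_div hn'.le]
    field_simp
  rw [e5]
  field_simp
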